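/- Let κ > 0 and P ≥ η^{−2}. Suppose Φ : ℝ × ℝ^d × ℝ^d → ℂ satisfies sup_{s,x,y} |∂_x^α ∂_y^β Φ(s,x,y)| ≤ D for all multi-indices |α|, |β| ≤ 10d and is supported in {|s| ≥ κL}. Then for all λ with 1 ≤ λ ≤ (log L)⁴, uniformly in (a, b, ξ, ζ) ∈ ℝ^{4d}: ∫_ℝ ⟨s/(δL^{2γ})⟩^{−P} · | ∑_{(x,y) ∈ ℤ_L^d × ℤ_L^d} Φ(s,x,y) χ₀((x−a)/λ) χ₀((y−b)/λ) e(x·ξ + y·ζ + s(x·y)) | ds ≤ C·D·λ^{4d}·L^{2d − 2(d−1)(1−γ) + η}, where C depends only on (d, γ, η, κ, χ₀). -/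

import Mathlib

open MeasureTheory
open scoped RealInnerProductSpace ENNReal NNReal BigOperators

noncomputable section

/-- `e(z) = e^{2πiz}`. -/
def efun (t : ℝ) : ℂ := Complex.exp (2 * (Real.pi : ℂ) * Complex.I * (t : ℂ))

/-- The rescaled lattice `ℤ_L^d = (L⁻¹ℤ)^d` inside `ℝ^d`. -/
def ZLat (d : ℕ) (L : ℝ) : Set (EuclideanSpace ℝ (Fin d)) :=
  {x | ∀ i, ∃ m : ℤ, x i = (m : ℝ) / L}

/-- Product cutoff `χ₀(z) = χ₀(z¹)⋯χ₀(z^d)` on `ℝ^d`. -/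
def cutoffProd (d : ℕ) (χ : ℝ → ℝ) (z : EuclideanSpace ℝ (Fin d)) : ℝ :=
  ∏ i, χ (z i)

/-- Directional derivative of a function along a vector. -/
def pderivAlong {X : Type*} [NormedAddCommGroup X] [NormedSpace ℝ X]
    (v : X) (f : X → ℂ) : X → ℂ :=
  fun z => fderiv ℝ f z v

/-- Iterated directional (partial) derivatives along a list of directions. -/
def pderivList {X : Type*} [NormedAddCommGroup X] [NormedSpace ℝ X]
    (l : List X) (f : X → ℂ) : X → ℂ :=
  l.foldr pderivAlong f

/-- The multi-index derivative bounds `sup_{s,x,y} |∂_x^α ∂_y^β Φ(s,x,y)| ≤ D`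
for all multi-indices `|α|, |β| ≤ 10d`. -/
def PhiDerivBound (d : ℕ) (D : ℝ)
    (Φ : ℝ → EuclideanSpace ℝ (Fin d) → EuclideanSpace ℝ (Fin d) → ℂ) : Prop :=
  ∀ lx ly : List (Fin d), lx.length ≤ 10 * d → ly.length ≤ 10 * d →
    ∀ (s : ℝ) (x y : EuclideanSpace ℝ (Fin d)),
      ‖pderivList (lx.map fun i => EuclideanSpace.single i (1 : ℝ))
          (fun x' => pderivList (ly.map fun i => EuclideanSpace.single i (1 : ℝ))
            (fun y' => Φ s x' y') y) x‖ ≤ D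

/-- The lattice sum over `ℤ_L^d × ℤ_L^d`. -/
def latSum (d : ℕ) (χ : ℝ → ℝ)
    (Φ : ℝ → EuclideanSpace ℝ (Fin d) → EuclideanSpace ℝ (Fin d) → ℂ)
    (lam L s : ℝ) (a b ξ ζ : EuclideanSpace ℝ (Fin d)) : ℂ :=
  ∑' q : ZLat d L × ZLat d L,
    (fun x y : EuclideanSpace ℝ (Fin d) =>
        Φ s x y *
          ((cutoffProd d χ (lam⁻¹ • (x - a)) * cutoffProd d χ (lam⁻¹ • (y - b)) : ℝ) : ℂ) *
          efun (⟪x, ξ⟫ + ⟪y, ζ⟫ + s * ⟪x, y⟫))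
      (↑q.1) (↑q.2)


lemma efun_add (x y : ℝ) : efun (x + y) = efun x * efun y := by
  unfold efun
  rw [← Complex.exp_add]
  congr 1
  push_cast
  ring

lemma norm_efun (x : ℝ) : ‖efun x‖ = 1 := by
  unfold efun
  have : 2 * (Real.pi : ℂ) * Complex.I * (x : ℂ) = ((2 * Real.pi * x : ℝ) : ℂ) * Complex.I := by
    push_cast
    ring
  rw [this, Complex.norm_exp_ofReal_mul_I]

lemma efun_zero : efun 0 = 1 := by simp [efun]

lemma efun_sum {ι : Type*} (s : Finset ι) (f : ι → ℝ) :
    efun (∑ i ∈ s, f i) = ∏ i ∈ s, efun (f i) := by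
  classical
  induction s using Finset.induction_on with
  | empty => simp [efun_zero]
  | insert i s hi ih => rw [Finset.sum_insert hi, Finset.prod_insert hi, efun_add, ih]

lemma norm_efun_add_efun_neg_sub_two (v : ℝ) :
    16 * (v - round v) ^ 2 ≤ ‖efun v + efun (-v) - 2‖ := by
  have h1 : efun v + efun (-v) - 2 = ((2 * Real.cos (2 * Real.pi * v) - 2 : ℝ) : ℂ) := by
    unfold efun
    push_cast
    rw [Complex.cos]
    have e1 : 2 * (Real.pi : ℂ) * Complex.I * (v : ℂ) = 2 * Real.pi * v * Complex.I := by ring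
    have e2 : 2 * (Real.pi : ℂ) * Complex.I * (-v : ℂ) = -(2 * Real.pi * v) * Complex.I := by ring
    rw [e1, e2]
    ring
  have h2 : Real.cos (2 * Real.pi * v) = Real.cos (2 * Real.pi * (v - round v)) := by
    rw [← Real.cos_sub_int_mul_two_pi _ (round v)]
    congr 1
    ring
  have h3 : |2 * Real.pi * (v - round v)| ≤ Real.pi := by
    rw [abs_mul, abs_of_pos (by positivity)]
    have := abs_sub_round v
    nlinarith [Real.pi_pos]
  have h4 := Real.cos_le_one_sub_mul_cos_sq h3
  have h5 : 2 / Real.pi ^ 2 * (2 * Real.pi * (v - round v)) ^ 2 = 8 * (v - round v) ^ 2 := by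
    field_simp
    ring
  rw [h1, Complex.norm_real, Real.norm_eq_abs, h2]
  rw [h5] at h4
  rw [abs_sub_comm]
  refine le_trans ?_ (le_abs_self _)
  linarith

/-- Summation by parts twice against an additive character. -/
lemma norm_sum_mul_efun_mul_le (u : ℤ → ℂ) (S : Finset ℤ) (hS : ∀ m ∉ S, u m = 0) (A v : ℝ)
    (hA : ∀ m, ‖u (m + 1) + u (m - 1) - 2 * u m‖ ≤ A) :
    ‖∑ m ∈ S, u m * efun (m * v)‖ * (16 * (v - round v) ^ 2) ≤ 3 * S.card * A := by
  have hA0 : 0 ≤ A := (norm_nonneg _).trans (hA 0)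
  set Z := ∑ m ∈ S, u m * efun (m * v) with hZ
  have hf : HasSum (fun m : ℤ => u m * efun (m * v)) Z :=
    hasSum_sum_of_ne_finset_zero fun m hm => by simp [hS m hm]
  have h1 : HasSum (fun m : ℤ => u (m + 1) * efun (m * v)) (Z * efun (-v)) := by
    have := (Equiv.hasSum_iff (Equiv.addRight (1 : ℤ))).2 (hf.mul_right (efun (-v)))
    have e : (fun m : ℤ => u (m + 1) * efun (m * v))
        = (fun m : ℤ => u m * efun (m * v) * efun (-v)) ∘ Equiv.addRight (1 : ℤ) := by
      funext m
      change _ = u (m + 1) * efun ((m + 1 : ℤ) * v) * efun (-v)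
      rw [mul_assoc, ← efun_add]
      push_cast
      ring_nf
    rw [e]
    exact this
  have h2 : HasSum (fun m : ℤ => u (m - 1) * efun (m * v)) (Z * efun v) := by
    have := (Equiv.hasSum_iff (Equiv.subRight (1 : ℤ))).2 (hf.mul_right (efun v))
    have e : (fun m : ℤ => u (m - 1) * efun (m * v))
        = (fun m : ℤ => u m * efun (m * v) * efun v) ∘ Equiv.subRight (1 : ℤ) := by
      funext m
      change _ = u (m - 1) * efun ((m - 1 : ℤ) * v) * efun v
      rw [mul_assoc, ← efun_add]
      push_cast
      ring_nf
    rw [e]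
    exact this
  have h3 := (h1.add h2).sub (hf.mul_left 2)
  set S' : Finset ℤ := S ∪ S.image (· + 1) ∪ S.image (· - 1) with hS'
  have hcard : (S'.card : ℝ) ≤ 3 * S.card := by
    have : S'.card ≤ 3 * S.card := by
      refine (Finset.card_union_le _ _).trans ?_
      have := Finset.card_union_le S (S.image (· + 1))
      have h1 : (S.image (· + 1)).card ≤ S.card := Finset.card_image_le
      have h2 : (S.image (· - 1)).card ≤ S.card := Finset.card_image_le
      omega
    exact_mod_cast this
  have h4 : HasSum _ (∑ m ∈ S', (u (m + 1) * efun (m * v) + u (m - 1) * efun (m * v)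
      - 2 * (u m * efun (m * v)))) := hasSum_sum_of_ne_finset_zero (by
    intro m hm
    simp only [hS', Finset.mem_union, Finset.mem_image, not_or, not_exists, not_and] at hm
    obtain ⟨⟨a, b⟩, c⟩ := hm
    have hb : m - 1 ∉ S := fun h => b _ h (by ring)
    have hc : m + 1 ∉ S := fun h => c _ h (by ring)
    simp [hS _ a, hS _ hb, hS _ hc])
  have h5 := h3.unique h4
  have h6 : Z * efun (-v) + Z * efun v - 2 * Z = Z * (efun v + efun (-v) - 2) := by ring
  rw [h6] at h5
  calc ‖Z‖ * (16 * (v - round v) ^ 2) ≤ ‖Z‖ * ‖efun v + efun (-v) - 2‖ := by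
        gcongr
        exact norm_efun_add_efun_neg_sub_two v
    _ = ‖Z * (efun v + efun (-v) - 2)‖ := (norm_mul _ _).symm
    _ ≤ ∑ m ∈ S', A := by
        rw [h5]
        refine norm_sum_le_of_le _ fun m _ => ?_
        have : u (m + 1) * efun (m * v) + u (m - 1) * efun (m * v) - 2 * (u m * efun (m * v))
            = (u (m + 1) + u (m - 1) - 2 * u m) * efun (m * v) := by ring
        rw [this, norm_mul, norm_efun, mul_one]
        exact hA m
    _ = S'.card * A := by simp
    _ ≤ 3 * S.card * A := by gcongr

lemma norm_sub_le_of_hasDerivAt {f f' : ℝ → ℂ} (hf : ∀ x, HasDerivAt f (f' x) x) {A : ℝ}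
    (hA : ∀ x, ‖f' x‖ ≤ A) (x y : ℝ) : ‖f y - f x‖ ≤ A * |y - x| := by
  have := Convex.norm_image_sub_le_of_norm_hasDerivWithin_le (s := Set.univ) (f := f) (f' := f')
    (C := A) (x := x) (y := y) (fun z _ => (hf z).hasDerivWithinAt) (fun z _ => hA z) convex_univ
    trivial trivial
  simpa using this

lemma norm_second_difference_le {f f' f'' : ℝ → ℂ} (hf : ∀ x, HasDerivAt f (f' x) x)
    (hf' : ∀ x, HasDerivAt f' (f'' x) x) {A : ℝ} (hA : ∀ x, ‖f'' x‖ ≤ A) (x h : ℝ) :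
    ‖f (x + h) + f (x - h) - 2 * f x‖ ≤ A * h ^ 2 := by
  have h1 : ∀ y, HasDerivAt (fun y => f (y + h) - f y) (f' (y + h) - f' y) y := fun y =>
    ((hf (y + h)).comp_add_const y h).sub (hf y)
  have h2 : ∀ y, ‖f' (y + h) - f' y‖ ≤ A * |h| := fun y => by
    simpa using norm_sub_le_of_hasDerivAt hf' hA y (y + h)
  have h3 := norm_sub_le_of_hasDerivAt h1 h2 (x - h) x
  have e1 : f (x + h) + f (x - h) - 2 * f x = f (x + h) - f x - (f (x - h + h) - f (x - h)) := by
    rw [sub_add_cancel]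
    ring
  rw [e1]
  refine h3.trans_eq ?_
  rw [sub_sub_cancel, mul_assoc, ← sq, sq_abs]

lemma card_le_of_abs_sub_le (S : Finset ℤ) (c R : ℝ) (hR : 0 ≤ R)
    (hS : ∀ m ∈ S, |(m : ℝ) - c| ≤ R) : (S.card : ℝ) ≤ 2 * R + 1 := by
  have hsub : S ⊆ Finset.Icc ⌈c - R⌉ ⌊c + R⌋ := fun m hm => by
    have := abs_le.1 (hS m hm)
    rw [Finset.mem_Icc, Int.ceil_le, Int.le_floor]
    constructor <;> linarith
  have h1 := Finset.card_le_card hsub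
  rw [Int.card_Icc] at h1
  have h2 : (S.card : ℝ) ≤ ((⌊c + R⌋ + 1 - ⌈c - R⌉).toNat : ℝ) := by exact_mod_cast h1
  refine h2.trans ?_
  have h3 : (((⌊c + R⌋ + 1 - ⌈c - R⌉).toNat : ℤ) : ℝ)
      = max ((⌊c + R⌋ : ℝ) + 1 - ⌈c - R⌉) 0 := by
    rw [Int.toNat_eq_max]
    push_cast
    rfl
  rw [Int.cast_natCast] at h3
  rw [h3]
  refine max_le ?_ (by linarith)
  have := Int.floor_le (c + R)
  have := Int.le_ceil (c - R)
  linarith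

/-- `K` bounds `χ` and its first two derivatives. -/
structure CutoffBound (χ : ℝ → ℝ) (K : ℝ) : Prop where
  contDiff : ContDiff ℝ 2 χ
  norm_le : ∀ x, ‖χ x‖ ≤ K
  norm_deriv_le : ∀ x, ‖deriv χ x‖ ≤ K
  norm_deriv_deriv_le : ∀ x, ‖deriv (deriv χ) x‖ ≤ K

lemma exists_cutoffBound {χ : ℝ → ℝ} (hχs : ContDiff ℝ (⊤ : ℕ∞) χ)
    (hχ0 : ∀ z : ℝ, 1 ≤ |z| → χ z = 0) : ∃ K, 1 ≤ K ∧ CutoffBound χ K := by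
  have hc : HasCompactSupport χ := by
    refine HasCompactSupport.intro (isCompact_Icc (a := (-1 : ℝ)) (b := 1)) fun x hx => hχ0 x ?_
    by_contra! h
    exact hx (Set.mem_Icc.2 (abs_le.1 h.le))
  have h2 : ContDiff ℝ 2 χ := by exact_mod_cast contDiff_infty.1 hχs 2
  have h1 : ContDiff ℝ 1 (deriv χ) := ContDiff.deriv' h2
  have h0 : Continuous (deriv (deriv χ)) := h1.continuous_deriv le_rfl
  obtain ⟨K0, hK0⟩ := h2.continuous.bounded_above_of_compact_support hc
  obtain ⟨K1, hK1⟩ := h1.continuous.bounded_above_of_compact_support hc.deriv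
  obtain ⟨K2, hK2⟩ := h0.bounded_above_of_compact_support hc.deriv.deriv
  refine ⟨max 1 (max K0 (max K1 K2)), le_max_left _ _, h2, fun x => (hK0 x).trans ?_,
    fun x => (hK1 x).trans ?_, fun x => (hK2 x).trans ?_⟩ <;> simp

/-- The integers `m` with `|m / L - b| ≤ lam`. -/
def latBox (L lam b : ℝ) : Finset ℤ := Finset.Icc ⌈L * b - lam * L⌉ ⌊L * b + lam * L⌋

lemma mem_latBox {L lam b : ℝ} {m : ℤ} : m ∈ latBox L lam b ↔ |(m : ℝ) - L * b| ≤ lam * L := by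
  rw [latBox, Finset.mem_Icc, Int.ceil_le, Int.le_floor, abs_le]
  constructor <;> rintro ⟨h1, h2⟩ <;> constructor <;> linarith

lemma card_latBox_le {L lam b : ℝ} (hL : 1 ≤ L) (hlam : 1 ≤ lam) :
    ((latBox L lam b).card : ℝ) ≤ 3 * (lam * L) := by
  have h1 : 1 ≤ lam * L := by nlinarith
  have := card_le_of_abs_sub_le (latBox L lam b) (L * b) (lam * L) (by linarith)
    fun m hm => mem_latBox.1 hm
  linarith

lemma cutoff_eq_zero_of_notMem {χ : ℝ → ℝ} (hχ0 : ∀ z : ℝ, 1 ≤ |z| → χ z = 0) {L lam b : ℝ}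
    (hL : 0 < L) (hlam : 0 < lam) {m : ℤ} (hm : m ∉ latBox L lam b) :
    χ (lam⁻¹ * (m / L - b)) = 0 := by
  apply hχ0
  rw [mem_latBox, not_le] at hm
  have h1 : lam⁻¹ * (m / L - b) = (lam * L)⁻¹ * (m - L * b) := by
    field_simp
  rw [h1, abs_mul, abs_inv, abs_of_pos (by positivity : 0 < lam * L), ← div_eq_inv_mul,
    le_div_iff₀ (by positivity)]
  linarith

lemma norm_sum_cutoff_mul_efun_mul_le {χ : ℝ → ℝ} {K : ℝ} (hK : CutoffBound χ K)
    (hχ0 : ∀ z : ℝ, 1 ≤ |z| → χ z = 0) {L lam : ℝ} (hL : 1 ≤ L) (hlam : 1 ≤ lam) (b v : ℝ)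
    {g g' g'' : ℝ → ℂ} (hg : ∀ x, HasDerivAt g (g' x) x) (hg' : ∀ x, HasDerivAt g' (g'' x) x)
    {D : ℝ} (h0 : ∀ x, ‖g x‖ ≤ D) (h1 : ∀ x, ‖g' x‖ ≤ D) (h2 : ∀ x, ‖g'' x‖ ≤ D) :
    ‖∑ m ∈ latBox L lam b, (χ (lam⁻¹ * (m / L - b)) : ℂ) * efun (m * v) * g (m / L)‖
      ≤ 6 * K * lam * L * (1 + (L * (v - round v)) ^ 2)⁻¹ * D := by
  have hL0 : 0 < L := by linarith
  have hlam0 : 0 < lam := by linarith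
  have hK0 : 0 ≤ K := (norm_nonneg _).trans (hK.norm_le 0)
  have hD0 : 0 ≤ D := (norm_nonneg _).trans (h0 0)
  have hi : lam⁻¹ ≤ 1 := inv_le_one_of_one_le₀ hlam
  have hi0 : 0 ≤ lam⁻¹ := by positivity
  have hcd1 : ContDiff ℝ 1 (deriv χ) := ContDiff.deriv' hK.contDiff
  have hχd : ∀ x, HasDerivAt χ (deriv χ x) x := fun x =>
    (hK.contDiff.differentiable (by norm_num) x).hasDerivAt
  have hχdd : ∀ x, HasDerivAt (deriv χ) (deriv (deriv χ) x) x := fun x =>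
    (hcd1.differentiable (by norm_num) x).hasDerivAt
  have hlin : ∀ x, HasDerivAt (fun x : ℝ => lam⁻¹ * (x - b)) lam⁻¹ x := fun x => by
    simpa using ((hasDerivAt_id x).sub_const b).const_mul lam⁻¹
  have hc : ∀ x, HasDerivAt (fun x : ℝ => ((χ (lam⁻¹ * (x - b)) : ℝ) : ℂ))
      ((deriv χ (lam⁻¹ * (x - b)) * lam⁻¹ : ℝ) : ℂ) x := fun x =>
    ((hχd _).comp x (hlin x)).ofReal_comp
  have hc' : ∀ x, HasDerivAt (fun x : ℝ => ((deriv χ (lam⁻¹ * (x - b)) * lam⁻¹ : ℝ) : ℂ))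
      ((deriv (deriv χ) (lam⁻¹ * (x - b)) * lam⁻¹ * lam⁻¹ : ℝ) : ℂ) x := fun x =>
    (((hχdd _).comp x (hlin x)).mul_const lam⁻¹).ofReal_comp
  have hf := fun x => (hc x).mul (hg x)
  have hf' := fun x => ((hc' x).mul (hg x)).add ((hc x).mul (hg' x))
  have b0 : ∀ x, ‖((χ (lam⁻¹ * (x - b)) : ℝ) : ℂ)‖ ≤ K := fun x => by
    rw [Complex.norm_real]
    exact hK.norm_le _
  have b1 : ∀ x, ‖((deriv χ (lam⁻¹ * (x - b)) * lam⁻¹ : ℝ) : ℂ)‖ ≤ K := fun x => by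
    rw [Complex.norm_real, norm_mul, Real.norm_of_nonneg hi0]
    exact (mul_le_of_le_one_right (norm_nonneg _) hi).trans (hK.norm_deriv_le _)
  have b2 : ∀ x, ‖((deriv (deriv χ) (lam⁻¹ * (x - b)) * lam⁻¹ * lam⁻¹ : ℝ) : ℂ)‖ ≤ K := fun x => by
    rw [Complex.norm_real, norm_mul, norm_mul, Real.norm_of_nonneg hi0]
    exact (mul_le_of_le_one_right (by positivity) hi).trans
      ((mul_le_of_le_one_right (norm_nonneg _) hi).trans (hK.norm_deriv_deriv_le _))
  set f : ℝ → ℂ := fun x => ((χ (lam⁻¹ * (x - b)) : ℝ) : ℂ) * g x with hfdef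
  have hsd := fun x h => norm_second_difference_le (f := f) hf hf' (A := 4 * K * D) (fun x => by
    refine (norm_add_le _ _).trans ?_
    refine (add_le_add (norm_add_le _ _) (norm_add_le _ _)).trans ?_
    simp only [norm_mul ((_ : ℝ) : ℂ) (_ : ℂ)]
    have a1 := mul_le_mul (b2 x) (h0 x) (norm_nonneg _) hK0
    have a2 := mul_le_mul (b1 x) (h1 x) (norm_nonneg _) hK0
    have a3 := mul_le_mul (b0 x) (h2 x) (norm_nonneg _) hK0
    linarith) x h
  have hsum : ∑ m ∈ latBox L lam b, (χ (lam⁻¹ * (m / L - b)) : ℂ) * efun (m * v) * g (m / L)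
      = ∑ m ∈ latBox L lam b, f (m / L) * efun (m * v) :=
    Finset.sum_congr rfl fun m _ => by rw [hfdef]; ring
  have hcard := card_latBox_le (b := b) hL hlam
  rw [hsum]
  have hmain := norm_sum_mul_efun_mul_le (fun m : ℤ => f (m / L)) (latBox L lam b)
    (fun m hm => by simp [hfdef, cutoff_eq_zero_of_notMem hχ0 hL0 hlam0 hm])
    (4 * K * D * (1 / L) ^ 2) v (fun m => by
      have := hsd (m / L) (1 / L)
      convert this using 5
      · push_cast; ring
      · push_cast; ring)
  have htriv : ‖∑ m ∈ latBox L lam b, f (m / L) * efun (m * v)‖ ≤ 3 * (lam * L) * (K * D) := by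
    refine (norm_sum_le_of_le (f := fun m : ℤ => f (m / L) * efun (m * v)) _
      (n := fun _ => K * D) fun m _ => ?_).trans ?_
    · rw [norm_mul, norm_efun, mul_one, norm_mul]
      exact mul_le_mul (b0 _) (h0 _) (norm_nonneg _) hK0
    · rw [Finset.sum_const, nsmul_eq_mul]
      gcongr
  set X := ‖∑ m ∈ latBox L lam b, f (m / L) * efun (m * v)‖
  set r := v - round v
  have hmain2 : X * (16 * r ^ 2) ≤ 3 * (3 * (lam * L)) * (4 * K * D * (1 / L) ^ 2) :=
    hmain.trans (by gcongr)
  have hmain3 : X * (16 * (L * r) ^ 2) ≤ 36 * (lam * L * (K * D)) := by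
    calc X * (16 * (L * r) ^ 2) = X * (16 * r ^ 2) * L ^ 2 := by ring
      _ ≤ 3 * (3 * (lam * L)) * (4 * K * D * (1 / L) ^ 2) * L ^ 2 := by gcongr
      _ = 36 * (lam * L * (K * D)) := by field_simp; ring
  have hp : 0 ≤ lam * L * (K * D) := by positivity
  have : X * (1 + (L * r) ^ 2) ≤ 6 * K * lam * L * D := by nlinarith
  calc X ≤ 6 * K * lam * L * D / (1 + (L * r) ^ 2) := by
        rwa [le_div_iff₀ (by positivity)]
    _ = _ := by ring

/-- `F` is `C^k` and all its partial derivatives of order at most `k` are bounded by `D`. -/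
def PartialDerivBound (d k : ℕ) (D : ℝ) (F : EuclideanSpace ℝ (Fin d) → ℂ) : Prop :=
  ContDiff ℝ k F ∧ ∀ l : List (Fin d), l.length ≤ k → ∀ y,
    ‖pderivList (l.map fun i => EuclideanSpace.single i (1 : ℝ)) F y‖ ≤ D

section PartialDerivatives

variable {X : Type*} [NormedAddCommGroup X] [NormedSpace ℝ X]

lemma pderivList_cons (v : X) (l : List X) (F : X → ℂ) :
    pderivList (v :: l) F = pderivAlong v (pderivList l F) := rfl

lemma contDiff_pderivList (l : List X) {F : X → ℂ} :
    ∀ {k : ℕ}, ContDiff ℝ (k + l.length : ℕ) F → ContDiff ℝ k (pderivList l F) := by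
  induction l with
  | nil => intro k h; exact h
  | cons v l ih =>
    intro k h
    have h1 : ContDiff ℝ (k + 1 : ℕ) (pderivList l F) := ih (by
      rw [List.length_cons] at h
      convert h using 2
      ring)
    exact (h1.fderiv_right (m := k) (by push_cast; exact le_rfl)).clm_apply contDiff_const

lemma pderivList_sum_mul_translate {ι : Type*} (S : Finset ι) (c : ι → ℂ) (w : ι → X)
    (l : List X) {F : X → ℂ} :
    ContDiff ℝ l.length F →
    pderivList l (fun y => ∑ m ∈ S, c m * F (y + w m))
      = fun y => ∑ m ∈ S, c m * pderivList l F (y + w m) := by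
  induction l with
  | nil => intro _; rfl
  | cons v l ih =>
    intro h
    have h' : ContDiff ℝ l.length F := h.of_le (by simp)
    have h1 : ContDiff ℝ (1 : ℕ) (pderivList l F) := contDiff_pderivList l (by
      convert h using 2
      simp [add_comm])
    rw [pderivList_cons, ih h']
    funext y
    unfold pderivAlong
    have hd : ∀ m ∈ S, HasFDerivAt (fun y => c m * pderivList l F (y + w m))
        (c m • fderiv ℝ (pderivList l F) (y + w m)) y := fun m _ => by
      have := (h1.differentiable (by norm_num) (y + w m)).hasFDerivAt
      exact ((hasFDerivAt_comp_add_right (w m)).2 this).const_mul (c m)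
    rw [(HasFDerivAt.fun_sum hd).fderiv]
    simp only [sum_apply, smul_apply, smul_eq_mul]
    rfl

lemma hasDerivAt_pderivAlong_line {G : X → ℂ} (hG : Differentiable ℝ G) (y v : X) (r : ℝ) :
    HasDerivAt (fun r : ℝ => G (y + r • v)) (pderivAlong v G (y + r • v)) r := by
  have h1 : HasDerivAt (fun r : ℝ => y + r • v) v r := by
    simpa using ((hasDerivAt_id r).smul_const v).const_add y
  exact (hG (y + r • v)).hasFDerivAt.comp_hasDerivAt r h1

end PartialDerivatives

lemma PartialDerivBound.sum_translate {d : ℕ} {χ : ℝ → ℝ} {K : ℝ} (hK : CutoffBound χ K)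
    (hχ0 : ∀ z : ℝ, 1 ≤ |z| → χ z = 0) {L lam : ℝ} (hL : 1 ≤ L) (hlam : 1 ≤ lam) (b v : ℝ)
    (j : Fin d) {k : ℕ} {D : ℝ} {F : EuclideanSpace ℝ (Fin d) → ℂ}
    (hF : PartialDerivBound d (k + 2) D F) :
    PartialDerivBound d k (6 * K * lam * L * (1 + (L * (v - round v)) ^ 2)⁻¹ * D)
      (fun y => ∑ m ∈ latBox L lam b, (χ (lam⁻¹ * (m / L - b)) : ℂ) * efun (m * v) *
        F (y + ((m : ℝ) / L) • EuclideanSpace.single j (1 : ℝ))) := by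
  obtain ⟨hc, hb⟩ := hF
  refine ⟨?_, fun l hl y => ?_⟩
  · have hck : ContDiff ℝ k F := hc.of_le (by push_cast; exact le_self_add)
    exact ContDiff.sum fun m _ => contDiff_const.mul (hck.comp (contDiff_id.add contDiff_const))
  · set l' := l.map fun i => (EuclideanSpace.single i (1 : ℝ) : EuclideanSpace ℝ (Fin d)) with hl'
    have hlen : l'.length = l.length := by simp [hl']
    rw [pderivList_sum_mul_translate _ _ _ _ (hc.of_le (by
      rw [hlen]
      exact_mod_cast (by omega : l.length ≤ k + 2)))]
    have hdiff : ContDiff ℝ (2 : ℕ) (pderivList l' F) := contDiff_pderivList l' (hc.of_le (by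
      rw [hlen]
      exact_mod_cast (by omega : 2 + l.length ≤ k + 2)))
    have hdiff1 : ContDiff ℝ (1 : ℕ)
        (pderivList (EuclideanSpace.single j (1 : ℝ) :: l') F) :=
      contDiff_pderivList _ (hc.of_le (by
        rw [List.length_cons, hlen]
        exact_mod_cast (by omega : 1 + (l.length + 1) ≤ k + 2)))
    have h0 := hb l (by omega)
    have h1 := hb (j :: l) (by simp; omega)
    have h2 := hb (j :: j :: l) (by simp; omega)
    refine norm_sum_cutoff_mul_efun_mul_le hK hχ0 hL hlam b v
      (g := fun r => pderivList l' F (y + r • EuclideanSpace.single j (1 : ℝ)))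
      (fun r => hasDerivAt_pderivAlong_line (hdiff.differentiable (by norm_num)) y _ r)
      (fun r => hasDerivAt_pderivAlong_line (hdiff1.differentiable (by norm_num)) y _ r)
      (fun r => h0 _) (fun r => h1 _) (fun r => h2 _)

lemma sum_piFinset_succ {M α : Type*} [AddCommMonoid M] {n : ℕ} (S : Fin (n + 1) → Finset α)
    (f : (Fin (n + 1) → α) → M) :
    ∑ m ∈ Fintype.piFinset S, f m
      = ∑ m' ∈ Fintype.piFinset (fun i => S i.succ), ∑ m₀ ∈ S 0, f (Fin.cons m₀ m') := by
  rw [← Finset.sum_product']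
  refine Finset.sum_bij' (fun m _ => (fun i => m i.succ, m 0)) (fun p _ => Fin.cons p.2 p.1)
    ?_ ?_ ?_ ?_ ?_
  · intro m hm
    rw [Fintype.mem_piFinset] at hm
    simp [hm]
  · rintro ⟨m', m₀⟩ h
    rw [Finset.mem_product, Fintype.mem_piFinset] at h
    rw [Fintype.mem_piFinset]
    intro i
    refine Fin.cases ?_ (fun i => ?_) i
    · exact h.2
    · exact h.1 i
  · intro m _
    exact Fin.cons_self_tail m
  · rintro ⟨m', m₀⟩ _
    rfl
  · intro m _
    exact congrArg f (Fin.cons_self_tail m).symm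

/-- Iterating one-dimensional functionals that lose two derivatives each. -/
lemma norm_sum_piFinset_le {E : Type*} [AddCommGroup E] (B : ℕ → ℝ → (E → ℂ) → Prop)
    (hB : ∀ D F, B 0 D F → ∀ y, ‖F y‖ ≤ D) :
    ∀ (n : ℕ) (S : Fin n → Finset ℤ) (c : Fin n → ℤ → ℂ) (w : Fin n → ℤ → E) (W : Fin n → ℝ),
      (∀ j k D F, B (k + 2) D F → B k (W j * D) (fun y => ∑ m ∈ S j, c j m * F (y + w j m))) →
      ∀ D F, B (2 * n) D F →
        ‖∑ m ∈ Fintype.piFinset S, (∏ j, c j (m j)) * F (∑ j, w j (m j))‖ ≤ (∏ j, W j) * D := by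
  intro n
  induction n with
  | zero =>
    intro S c w W _ D F hF
    simpa using hB D F hF 0
  | succ n ih =>
    intro S c w W hstep D F hF
    have h1 := hstep 0 (2 * n) D F hF
    have h2 := ih (fun i => S i.succ) (fun i => c i.succ) (fun i => w i.succ) (fun i => W i.succ)
      (fun j => hstep j.succ) _ _ h1
    rw [sum_piFinset_succ, Fin.prod_univ_succ]
    calc _ = _ := by
          congr 1
          refine Finset.sum_congr rfl fun m' _ => ?_
          rw [Finset.mul_sum]
          refine Finset.sum_congr rfl fun m₀ _ => ?_
          rw [Fin.prod_univ_succ, Fin.sum_univ_succ]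
          simp only [Fin.cons_zero, Fin.cons_succ]
          rw [add_comm (w 0 m₀)]
          ring
      _ ≤ _ := h2
      _ = _ := by ring

/-- The lattice point `n / L`. -/
def latPoint (d : ℕ) (L : ℝ) (n : Fin d → ℤ) : EuclideanSpace ℝ (Fin d) :=
  WithLp.toLp 2 fun i => (n i : ℝ) / L

lemma latPoint_apply (d : ℕ) (L : ℝ) (n : Fin d → ℤ) (i : Fin d) :
    latPoint d L n i = (n i : ℝ) / L := rfl

lemma latPoint_eq_sum (d : ℕ) (L : ℝ) (n : Fin d → ℤ) :
    latPoint d L n = ∑ j, ((n j : ℝ) / L) • EuclideanSpace.single j (1 : ℝ) := by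
  ext i
  rw [latPoint_apply]
  simp [WithLp.ofLp_sum, Finset.sum_apply, Pi.single_apply]

/-- The parametrization of `ZLat d L` by `ℤ^d`. -/
def latEquiv (d : ℕ) {L : ℝ} (hL : L ≠ 0) : (Fin d → ℤ) ≃ ZLat d L :=
  Equiv.ofBijective (fun n => ⟨latPoint d L n, fun i => ⟨n i, rfl⟩⟩) (by
    constructor
    · intro n m h
      funext i
      have := congrArg (fun z : ZLat d L => (z : EuclideanSpace ℝ (Fin d)) i) h
      simp only [latPoint_apply] at this
      rw [div_left_inj' hL] at this
      exact_mod_cast this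
    · rintro ⟨x, hx⟩
      have hx' := hx
      choose n hn using hx'
      refine ⟨n, Subtype.ext ?_⟩
      ext i
      rw [latPoint_apply, hn i])

/-- The decay weight in the frequency variable modulo `1`. -/
def freqWeight (L w : ℝ) : ℝ := (1 + (L * (w - round w)) ^ 2)⁻¹

lemma freqWeight_nonneg (L w : ℝ) : 0 ≤ freqWeight L w := by
  unfold freqWeight
  positivity

lemma freqWeight_le_one (L w : ℝ) : freqWeight L w ≤ 1 := by
  unfold freqWeight
  exact inv_le_one_of_one_le₀ (by nlinarith [sq_nonneg (L * (w - round w))])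

lemma cutoffProd_latPoint (d : ℕ) (χ : ℝ → ℝ) (L lam : ℝ) (a : EuclideanSpace ℝ (Fin d))
    (n : Fin d → ℤ) :
    cutoffProd d χ (lam⁻¹ • (latPoint d L n - a)) = ∏ i, χ (lam⁻¹ * (n i / L - a i)) := by
  simp [cutoffProd, latPoint_apply]

lemma cutoffProd_latPoint_eq_zero {d : ℕ} {χ : ℝ → ℝ} (hχ0 : ∀ z : ℝ, 1 ≤ |z| → χ z = 0)
    {L lam : ℝ} (hL : 0 < L) (hlam : 0 < lam) (a : EuclideanSpace ℝ (Fin d)) {n : Fin d → ℤ}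
    (hn : n ∉ Fintype.piFinset fun i => latBox L lam (a i)) :
    cutoffProd d χ (lam⁻¹ • (latPoint d L n - a)) = 0 := by
  rw [Fintype.mem_piFinset, not_forall] at hn
  obtain ⟨i, hi⟩ := hn
  rw [cutoffProd_latPoint]
  exact Finset.prod_eq_zero (Finset.mem_univ i) (cutoff_eq_zero_of_notMem hχ0 hL hlam hi)

lemma latSum_eq_sum {d : ℕ} {χ : ℝ → ℝ} (hχ0 : ∀ z : ℝ, 1 ≤ |z| → χ z = 0)
    (Φ : ℝ → EuclideanSpace ℝ (Fin d) → EuclideanSpace ℝ (Fin d) → ℂ)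
    {L lam : ℝ} (hL : 0 < L) (hlam : 0 < lam) (s : ℝ) (a b ξ ζ : EuclideanSpace ℝ (Fin d)) :
    latSum d χ Φ lam L s a b ξ ζ =
      ∑ n ∈ Fintype.piFinset fun i => latBox L lam (a i),
        ((∏ i, χ (lam⁻¹ * (n i / L - a i)) : ℝ) : ℂ) * efun ⟪latPoint d L n, ξ⟫ *
        ∑ m ∈ Fintype.piFinset fun i => latBox L lam (b i),
          (∏ j, (χ (lam⁻¹ * (m j / L - b j)) : ℂ) * efun (m j * (ζ j / L + s * n j / L ^ 2))) *
            Φ s (latPoint d L n) (∑ j, ((m j : ℝ) / L) • EuclideanSpace.single j (1 : ℝ)) := by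
  classical
  unfold latSum
  rw [← ((latEquiv d hL.ne').prodCongr (latEquiv d hL.ne')).tsum_eq]
  rw [tsum_eq_sum (s := (Fintype.piFinset fun i => latBox L lam (a i)) ×ˢ
    (Fintype.piFinset fun i => latBox L lam (b i)))]
  · rw [Finset.sum_product]
    refine Finset.sum_congr rfl fun n _ => ?_
    rw [Finset.mul_sum]
    refine Finset.sum_congr rfl fun m _ => ?_
    change Φ s (latPoint d L n) (latPoint d L m) *
      ((cutoffProd d χ (lam⁻¹ • (latPoint d L n - a)) *
        cutoffProd d χ (lam⁻¹ • (latPoint d L m - b)) : ℝ) : ℂ) *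
      efun (⟪latPoint d L n, ξ⟫ + ⟪latPoint d L m, ζ⟫ + s * ⟪latPoint d L n, latPoint d L m⟫) = _
    have h1 : ⟪latPoint d L n, ξ⟫ + ⟪latPoint d L m, ζ⟫ + s * ⟪latPoint d L n, latPoint d L m⟫
        = ⟪latPoint d L n, ξ⟫ + ∑ j, (m j * (ζ j / L + s * n j / L ^ 2)) := by
      rw [add_assoc]
      congr 1
      rw [PiLp.inner_apply, PiLp.inner_apply, Finset.mul_sum, ← Finset.sum_add_distrib]
      refine Finset.sum_congr rfl fun j _ => ?_
      have hin : ∀ x y : ℝ, ⟪x, y⟫ = x * y := fun x y => by simp [mul_comm]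
      rw [hin, hin, latPoint_apply, latPoint_apply]
      field_simp
    rw [h1, efun_add, efun_sum, cutoffProd_latPoint, cutoffProd_latPoint, ← latPoint_eq_sum,
      Finset.prod_mul_distrib]
    push_cast
    ring
  · rintro ⟨n, m⟩ hnm
    change Φ s (latPoint d L n) (latPoint d L m) *
      ((cutoffProd d χ (lam⁻¹ • (latPoint d L n - a)) *
        cutoffProd d χ (lam⁻¹ • (latPoint d L m - b)) : ℝ) : ℂ) *
      efun (⟪latPoint d L n, ξ⟫ + ⟪latPoint d L m, ζ⟫ + s * ⟪latPoint d L n, latPoint d L m⟫) = 0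
    rw [Finset.mem_product, not_and_or] at hnm
    rcases hnm with h | h
    · simp [cutoffProd_latPoint_eq_zero hχ0 hL hlam a h]
    · simp [cutoffProd_latPoint_eq_zero hχ0 hL hlam b h]

lemma norm_latSum_le {d : ℕ} {χ : ℝ → ℝ} {K : ℝ} (hK : CutoffBound χ K)
    (hχ0 : ∀ z : ℝ, 1 ≤ |z| → χ z = 0)
    {Φ : ℝ → EuclideanSpace ℝ (Fin d) → EuclideanSpace ℝ (Fin d) → ℂ} {L lam D s : ℝ}
    (hL : 1 ≤ L) (hlam : 1 ≤ lam)
    (hΦ : ContDiff ℝ (20 * d : ℕ)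
        (fun p : EuclideanSpace ℝ (Fin d) × EuclideanSpace ℝ (Fin d) => Φ s p.1 p.2))
    (hD : PhiDerivBound d D Φ) (a b ξ ζ : EuclideanSpace ℝ (Fin d)) :
    ‖latSum d χ Φ lam L s a b ξ ζ‖ ≤ K ^ d * (6 * K * lam * L) ^ d * D *
      ∏ j, ∑ n ∈ latBox L lam (a j), freqWeight L (ζ j / L + s * n / L ^ 2) := by
  have hK0 : 0 ≤ K := (norm_nonneg _).trans (hK.norm_le 0)
  rw [latSum_eq_sum hχ0 Φ (by linarith) (by linarith), Finset.prod_univ_sum, Finset.mul_sum]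
  refine norm_sum_le_of_le _ fun n _ => ?_
  have hinner : PartialDerivBound d (2 * d) D (Φ s (latPoint d L n)) := by
    constructor
    · have : ContDiff ℝ (20 * d : ℕ) (Φ s (latPoint d L n)) :=
        hΦ.comp (contDiff_const.prodMk contDiff_id)
      exact this.of_le (by exact_mod_cast (by omega : 2 * d ≤ 20 * d))
    · intro l hl y
      exact hD [] l (by simp) (by omega) s (latPoint d L n) y
  have hmain := norm_sum_piFinset_le (PartialDerivBound d)
    (fun D F h y => by simpa [pderivList] using h.2 [] (by simp) y) d
    (fun i => latBox L lam (b i))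
    (fun j m => (χ (lam⁻¹ * (m / L - b j)) : ℂ) * efun (m * (ζ j / L + s * n j / L ^ 2)))
    (fun j m => ((m : ℝ) / L) • EuclideanSpace.single j (1 : ℝ))
    (fun j => 6 * K * lam * L * freqWeight L (ζ j / L + s * n j / L ^ 2))
    (fun j k D F h => h.sum_translate hK hχ0 hL hlam (b j) _ j) D _ hinner
  rw [norm_mul, norm_mul, norm_efun, mul_one, Complex.norm_real, norm_prod]
  have h1 : ∏ i, ‖χ (lam⁻¹ * (n i / L - a i))‖ ≤ K ^ d := by
    refine (Finset.prod_le_prod (fun i _ => norm_nonneg _) (fun i _ => hK.norm_le _)).trans ?_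
    simp
  refine (mul_le_mul h1 hmain (norm_nonneg _) (by positivity)).trans_eq ?_
  rw [Finset.prod_mul_distrib]
  simp
  ring

lemma card_le_of_near_integers {t c L lam Y : ℝ} (r : ℚ) (hL : 1 ≤ L) (hlam : 1 ≤ lam)
    (hq : (r.den : ℝ) ≤ L) (hr : |t - r| * (L * r.den) ≤ 1) (hY : 0 ≤ Y)
    (hk : ∀ k : ℤ, r.den * |(k : ℝ)| ≤ 2 * lam * L → r.den * |t - r| * |(k : ℝ)| ≤ 1 / L →
      |(k : ℝ)| ≤ Y)
    (A : Finset ℤ) (hA : ∀ n ∈ A, ∀ n' ∈ A, |(n : ℝ) - n'| ≤ 2 * lam * L)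
    (hc : ∀ n ∈ A, ∃ z : ℤ, |c + t * n - z| ≤ 1 / (2 * L)) :
    (A.card : ℝ) ≤ (6 * lam + 1) * (2 * Y + 1) := by
  classical
  have hL0 : 0 < L := by linarith
  have hq0 : (0 : ℝ) < r.den := by exact_mod_cast r.den_pos
  have hrq : (r : ℝ) * r.den = r.num := by exact_mod_cast Rat.mul_den_eq_num r
  choose! z hz using hc
  have hdiff : ∀ n ∈ A, ∀ n' ∈ A, |t * ((n : ℝ) - n') - (z n - z n')| ≤ 1 / L := by
    intro n hn n' hn'
    have e : t * ((n : ℝ) - n') - (z n - z n') = (c + t * n - z n) - (c + t * n' - z n') := by ring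
    rw [e]
    refine (abs_sub _ _).trans ((add_le_add (hz n hn) (hz n' hn')).trans_eq ?_)
    field_simp
    norm_num
  rcases A.eq_empty_or_nonempty with rfl | ⟨n₀, hn₀⟩
  · simp
    positivity
  set f : ℤ → ℤ := fun n => r.num * (n - n₀) - r.den * (z n - z n₀) with hf
  have himage : ((A.image f).card : ℝ) ≤ 6 * lam + 1 := by
    have := card_le_of_abs_sub_le (A.image f) 0 (3 * lam) (by linarith) (by
      intro j hj
      obtain ⟨n, hn, rfl⟩ := Finset.mem_image.1 hj
      have e : ((f n : ℤ) : ℝ) - 0 = r.den * ((t * ((n : ℝ) - n₀) - (z n - z n₀))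
          - (t - r) * (n - n₀)) := by
        simp only [hf]
        push_cast
        rw [← hrq]
        ring
      rw [e, abs_mul, abs_of_pos hq0]
      have h1 := hdiff n hn n₀ hn₀
      have h2 := hA n hn n₀ hn₀
      calc (r.den : ℝ) * |(t * ((n : ℝ) - n₀) - (z n - z n₀)) - (t - r) * (n - n₀)|
          ≤ r.den * (1 / L + |t - r| * (2 * lam * L)) := by
            gcongr
            refine (abs_sub _ _).trans (add_le_add h1 ?_)
            rw [abs_mul]
            gcongr
        _ = r.den / L + 2 * lam * (|t - r| * (L * r.den)) := by ring
        _ ≤ 1 + 2 * lam * 1 := by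
            gcongr
            exact (div_le_one hL0).2 hq
        _ ≤ 3 * lam := by linarith)
    linarith
  have hfiber : ∀ j ∈ A.image f, (((A.filter fun n => f n = j).card : ℕ) : ℝ) ≤ 2 * Y + 1 := by
    intro j hj
    obtain ⟨n₁, hn₁, hj₁⟩ := Finset.mem_image.1 hj
    have hdvd : ∀ n ∈ A.filter (fun n => f n = j), ∃ k : ℤ, n - n₁ = r.den * k ∧
        z n - z n₁ = r.num * k := by
      intro n hn
      obtain ⟨hn, hnj⟩ := Finset.mem_filter.1 hn
      have h1 : r.num * (n - n₁) = r.den * (z n - z n₁) := by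
        have : f n = f n₁ := hnj.trans hj₁.symm
        simp only [hf] at this
        linarith
      have hcop : IsCoprime (r.den : ℤ) r.num := by
        rw [Int.isCoprime_iff_gcd_eq_one]
        have := r.reduced
        rw [Nat.Coprime, Nat.gcd_comm] at this
        simpa [Int.gcd] using this
      obtain ⟨k, hk⟩ := hcop.dvd_of_dvd_mul_left (Dvd.intro _ h1.symm)
      refine ⟨k, hk, ?_⟩
      have hq0' : (r.den : ℤ) ≠ 0 := by exact_mod_cast r.den_ne_zero
      apply mul_left_cancel₀ hq0'
      rw [← h1, hk]
      ring
    choose! k hk1 hk2 using hdvd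
    have hinj : Set.InjOn k (A.filter fun n => f n = j) := by
      intro n hn n' hn' h
      have h1 := hk1 n (by exact_mod_cast hn)
      have h2 := hk1 n' (by exact_mod_cast hn')
      rw [h] at h1
      linarith
    rw [← Finset.card_image_of_injOn hinj]
    refine card_le_of_abs_sub_le _ 0 Y hY fun k' hk' => ?_
    obtain ⟨n, hn, rfl⟩ := Finset.mem_image.1 hk'
    have hnA := (Finset.mem_filter.1 hn).1
    have e1 : (n : ℝ) - n₁ = r.den * k n := by exact_mod_cast hk1 n hn
    have e2 : (z n : ℝ) - z n₁ = r.num * k n := by exact_mod_cast hk2 n hn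
    rw [sub_zero]
    apply hk
    · have := hA n hnA n₁ hn₁
      rwa [e1, abs_mul, abs_of_pos hq0] at this
    · have := hdiff n hnA n₁ hn₁
      rw [e1, e2, ← hrq] at this
      have e3 : t * (r.den * (k n : ℝ)) - r * r.den * k n = r.den * (t - r) * k n := by ring
      rwa [e3, abs_mul, abs_mul, abs_of_pos hq0] at this
  rw [Finset.card_eq_sum_card_image f A]
  push_cast
  calc ∑ j ∈ A.image f, (((A.filter fun n => f n = j).card : ℕ) : ℝ)
      ≤ ∑ j ∈ A.image f, (2 * Y + 1) := Finset.sum_le_sum hfiber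
    _ = (A.image f).card * (2 * Y + 1) := by rw [Finset.sum_const, nsmul_eq_mul]
    _ ≤ _ := by gcongr

lemma summable_three_div_one_add_sq : Summable fun k : ℤ => 3 / (1 + (k : ℝ) ^ 2) := by
  have h := ((Real.summable_one_div_int_pow (p := 2)).2 (by norm_num)).mul_left 3
  refine Summable.of_norm_bounded_eventually h ?_
  have : {k : ℤ | ¬ ‖3 / (1 + (k : ℝ) ^ 2)‖ ≤ 3 * (1 / (k : ℝ) ^ 2)} ⊆ {0} := by
    intro k hk
    by_contra hk0
    apply hk
    have hk1 : (k : ℝ) ≠ 0 := by exact_mod_cast hk0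
    rw [Real.norm_of_nonneg (by positivity), mul_one_div]
    gcongr
    linarith
  exact (Set.finite_singleton 0).subset this

/-- The total mass of the majorant of `freqWeight` on unit cells. -/
def cellMass : ℝ := ∑' k : ℤ, 3 / (1 + (k : ℝ) ^ 2)

lemma cellMass_nonneg : 0 ≤ cellMass := tsum_nonneg fun k => by positivity

lemma freqWeight_le_cell (L w : ℝ) :
    freqWeight L w ≤ 3 / (1 + (⌊L * (w - round w)⌋ : ℝ) ^ 2) := by
  unfold freqWeight
  set x := L * (w - round w)
  have h1 := Int.floor_le x
  have h2 := Int.lt_floor_add_one x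
  set k := ⌊x⌋
  rw [inv_eq_one_div, div_le_div_iff₀ (by positivity) (by positivity)]
  rcases le_or_gt 0 k with hk | hk
  · have : (0 : ℝ) ≤ k := by exact_mod_cast hk
    nlinarith
  · have : (k : ℝ) ≤ -1 := by exact_mod_cast (by omega : k ≤ -1)
    nlinarith [sq_nonneg (2 * (k : ℝ) + 3)]

lemma sum_freqWeight_le {L B : ℝ} (hB : 0 ≤ B) (w : ℤ → ℝ) (A : Finset ℤ)
    (h : ∀ k : ℤ, ((A.filter fun n => ⌊L * (w n - round (w n))⌋ = k).card : ℝ) ≤ B) :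
    ∑ n ∈ A, freqWeight L (w n) ≤ B * cellMass := by
  classical
  set κ : ℤ → ℤ := fun n => ⌊L * (w n - round (w n))⌋ with hκ
  calc ∑ n ∈ A, freqWeight L (w n) ≤ ∑ n ∈ A, 3 / (1 + (κ n : ℝ) ^ 2) :=
        Finset.sum_le_sum fun n _ => freqWeight_le_cell L (w n)
    _ = ∑ k ∈ A.image κ, ∑ n ∈ A.filter (fun n => κ n = k), 3 / (1 + (κ n : ℝ) ^ 2) :=
        (Finset.sum_fiberwise_of_maps_to (fun n hn => Finset.mem_image_of_mem κ hn) _).symm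
    _ ≤ ∑ k ∈ A.image κ, B * (3 / (1 + (k : ℝ) ^ 2)) := by
        refine Finset.sum_le_sum fun k _ => ?_
        have : ∑ n ∈ A.filter (fun n => κ n = k), 3 / (1 + (κ n : ℝ) ^ 2)
            = ∑ n ∈ A.filter (fun n => κ n = k), 3 / (1 + (k : ℝ) ^ 2) :=
          Finset.sum_congr rfl fun n hn => by rw [(Finset.mem_filter.1 hn).2]
        rw [this, Finset.sum_const, nsmul_eq_mul]
        gcongr
        exact h k
    _ = B * ∑ k ∈ A.image κ, 3 / (1 + (k : ℝ) ^ 2) := by rw [Finset.mul_sum]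
    _ ≤ B * cellMass := by
        gcongr
        exact summable_three_div_one_add_sq.sum_le_tsum _ fun k _ => by positivity

/-- The size of a major arc contribution: `L / q` damped at distance `L⁻²` from `r = a / q`. -/
def arcSize (L t : ℝ) (r : ℚ) : ℝ := L / r.den / max 1 (L ^ 2 * |t - r|)

lemma one_le_arcSize {L t : ℝ} {r : ℚ} (hL : 1 ≤ L) (hq : (r.den : ℝ) ≤ L)
    (hr : |t - r| * (L * r.den) ≤ 1) : 1 ≤ arcSize L t r := by
  have hq0 : (0 : ℝ) < r.den := by exact_mod_cast r.den_pos
  have hL0 : 0 < L := by linarith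
  rw [arcSize, le_div_iff₀ (by positivity), one_mul, max_le_iff]
  refine ⟨(one_le_div hq0).2 hq, ?_⟩
  rw [le_div_iff₀ hq0]
  calc L ^ 2 * |t - r| * r.den = L * (|t - r| * (L * r.den)) := by ring
    _ ≤ L * 1 := by gcongr
    _ = L := mul_one L

lemma sum_latBox_freqWeight_le {L lam t : ℝ} {r : ℚ} (hL : 1 ≤ L) (hlam : 1 ≤ lam)
    (hq : (r.den : ℝ) ≤ L) (hr : |t - r| * (L * r.den) ≤ 1) (α c : ℝ) :
    ∑ n ∈ latBox L lam α, freqWeight L (c + t * n)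
      ≤ 35 * cellMass * lam ^ 2 * arcSize L t r := by
  have hX := one_le_arcSize hL hq hr
  have hq0 : (0 : ℝ) < r.den := by exact_mod_cast r.den_pos
  have hL0 : 0 < L := by linarith
  set X := arcSize L t r with hXdef
  have hB : 0 ≤ (6 * lam + 1) * (2 * (2 * lam * X) + 1) := by positivity
  refine (sum_freqWeight_le hB (fun n => c + t * n) _ fun k => ?_).trans ?_
  · refine card_le_of_near_integers (c := c - (k + 1 / 2) / L) r hL hlam hq hr (by positivity)
      ?_ _ ?_ ?_
    · intro k h1 h2
      rw [hXdef, arcSize, ← mul_div_assoc, le_div_iff₀ (by positivity), ← mul_div_assoc,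
        le_div_iff₀ hq0]
      rcases max_cases 1 (L ^ 2 * |t - r|) with ⟨h, _⟩ | ⟨h, _⟩ <;> rw [h]
      · linarith
      · rw [le_div_iff₀ hL0] at h2
        calc |(k : ℝ)| * (L ^ 2 * |t - r|) * r.den = L * (r.den * |t - r| * |(k : ℝ)| * L) := by ring
          _ ≤ L * 1 := by gcongr
          _ ≤ 2 * lam * L := by nlinarith
    · intro n hn n' hn'
      have h1 := abs_le.1 (mem_latBox.1 (Finset.mem_filter.1 hn).1)
      have h2 := abs_le.1 (mem_latBox.1 (Finset.mem_filter.1 hn').1)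
      rw [abs_le]
      constructor <;> linarith
    · intro n hn
      have h := (Finset.mem_filter.1 hn).2
      rw [Int.floor_eq_iff] at h
      refine ⟨round (c + t * n), ?_⟩
      have e : c - (k + 1 / 2) / L + t * n - round (c + t * n)
          = (L * (c + t * n - round (c + t * n)) - (k + 1 / 2)) / L := by
        field_simp
        ring
      rw [e, abs_div, abs_of_pos hL0, div_le_div_iff₀ hL0 (by positivity)]
      have : |L * (c + t * n - round (c + t * n)) - (k + 1 / 2)| ≤ 1 / 2 := by
        rw [abs_le]
        constructor <;> linarith [h.1, h.2]
      nlinarith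
  · have h1 : (6 * lam + 1) * (2 * (2 * lam * X) + 1) ≤ (7 * lam) * (5 * (lam * X)) := by
      have : 1 ≤ lam * X := by nlinarith
      gcongr <;> linarith
    calc (6 * lam + 1) * (2 * (2 * lam * X) + 1) * cellMass
        ≤ (7 * lam) * (5 * (lam * X)) * cellMass := by
          gcongr
          exact cellMass_nonneg
      _ = _ := by ring

lemma exists_rat_arc {L : ℝ} (hL : 1 ≤ L) (t : ℝ) :
    ∃ r : ℚ, (r.den : ℝ) ≤ L ∧ |t - r| * (L * r.den) ≤ 1 := by
  obtain ⟨r, hr, hd⟩ := Real.exists_rat_abs_sub_le_and_den_le t (Nat.floor_pos.2 hL)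
  have hq0 : (0 : ℝ) < r.den := by exact_mod_cast r.den_pos
  refine ⟨r, (Nat.cast_le.2 hd).trans (Nat.floor_le (by linarith)), ?_⟩
  rw [le_div_iff₀ (by positivity)] at hr
  refine le_trans ?_ hr
  gcongr
  exact (Nat.lt_floor_add_one L).le

lemma arcSize_pow_le {L t : ℝ} {r : ℚ} (hL : 1 ≤ L) {d : ℕ} (hd : 2 ≤ d) :
    arcSize L t r ^ d ≤ (L / r.den) ^ d * (2 * (1 + (L ^ 2 * (t - r)) ^ 2)⁻¹) := by
  have hq0 : (0 : ℝ) < r.den := by exact_mod_cast r.den_pos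
  rw [arcSize, div_pow, div_eq_mul_inv]
  gcongr
  set u := L ^ 2 * |t - r| with hu
  have hu0 : 0 ≤ u := by positivity
  have e : (L ^ 2 * (t - r)) ^ 2 = u ^ 2 := by rw [hu, mul_pow, mul_pow, sq_abs]
  rw [e, ← div_eq_mul_inv, inv_eq_one_div, div_le_div_iff₀ (by positivity) (by positivity), one_mul]
  have h1 : 1 ≤ max 1 u := le_max_left _ _
  have h2 : u ≤ max 1 u := le_max_right _ _
  have h3 : max 1 u ^ 2 ≤ max 1 u ^ d := pow_le_pow_right₀ h1 hd
  nlinarith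

lemma integrable_inv_one_add_sq_comp (c w : ℝ) (hw : 0 < w) :
    Integrable fun s : ℝ => (1 + ((s - c) / w) ^ 2)⁻¹ :=
  ((integrable_inv_one_add_sq).comp_div hw.ne').comp_sub_right c

lemma integral_inv_one_add_sq_comp (c w : ℝ) (hw : 0 < w) :
    ∫ s : ℝ, (1 + ((s - c) / w) ^ 2)⁻¹ = Real.pi * w := by
  rw [integral_sub_right_eq_self (fun s : ℝ => (1 + (s / w) ^ 2)⁻¹) c,
    Measure.integral_comp_div (fun s : ℝ => (1 + s ^ 2)⁻¹) w, integral_univ_inv_one_add_sq,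
    abs_of_pos hw, smul_eq_mul, mul_comm]

/-- The nonzero numerators of the fractions with denominator `q` close to `[-R / L², R / L²]`. -/
def arcNumerators (L R : ℝ) (q : ℕ) : Finset ℤ :=
  (latBox 1 (2 * R * q / L ^ 2) 0).filter (· ≠ 0)

lemma mem_arcNumerators {L R : ℝ} {q : ℕ} {a : ℤ} :
    a ∈ arcNumerators L R q ↔ |(a : ℝ)| ≤ 2 * R * q / L ^ 2 ∧ a ≠ 0 := by
  rw [arcNumerators, Finset.mem_filter, mem_latBox]
  simp

lemma card_arcNumerators_mul_le {L R : ℝ} (hL : 1 ≤ L) (hR : 0 ≤ R) {q : ℕ} (hq : 1 ≤ q) {d : ℕ}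
    (hd : 2 ≤ d) :
    ((arcNumerators L R q).card : ℝ) * (L / q) ^ d
      ≤ 3 * 2 ^ (d - 1) * (R ^ (d - 1) * L ^ 2 / L ^ d) * (q : ℝ)⁻¹ := by
  have hq0 : (0 : ℝ) < q := by exact_mod_cast hq
  have hL0 : 0 < L := by linarith
  rcases (arcNumerators L R q).eq_empty_or_nonempty with h | ⟨a, ha⟩
  · rw [h]
    simp only [Finset.card_empty, Nat.cast_zero, zero_mul]
    positivity
  · set x := 2 * R * q / L ^ 2 with hx
    have h1 : 1 ≤ x := by
      have := mem_arcNumerators.1 ha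
      have h2 : (1 : ℝ) ≤ |(a : ℝ)| := by exact_mod_cast Int.one_le_abs this.2
      exact h2.trans this.1
    have h2 : ((arcNumerators L R q).card : ℝ) ≤ 2 * x + 1 :=
      card_le_of_abs_sub_le _ 0 x (by linarith) fun m hm => by
        simpa using (mem_arcNumerators.1 hm).1
    obtain ⟨e, rfl⟩ : ∃ e, d = e + 1 := ⟨d - 1, by omega⟩
    have h3 : x ≤ x ^ e := le_self_pow₀ h1 (by omega)
    calc ((arcNumerators L R q).card : ℝ) * (L / q) ^ (e + 1)
        ≤ (3 * x ^ e) * (L / q) ^ (e + 1) := by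
          gcongr
          linarith
      _ = _ := by
          rw [hx, Nat.add_sub_cancel, div_pow, div_pow, mul_pow, mul_pow]
          field_simp
          ring

/-- Majorant of the `d`-th power of the arc sizes. -/
def arcMajorant (d : ℕ) (κ L R s : ℝ) : ℝ :=
  (∑ q ∈ Finset.Icc 1 ⌊L⌋₊, ∑ a ∈ arcNumerators L R q,
    (L / q) ^ d * (2 * (1 + ((s - L ^ 2 * (a / q)) / 1) ^ 2)⁻¹)) +
  κ⁻¹ ^ d * (R / (κ * L)) ^ (d - 1) * (2 * (1 + ((s - 0) / L) ^ 2)⁻¹)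

lemma integrable_arcMajorant (d : ℕ) (κ R : ℝ) {L : ℝ} (hL : 0 < L) :
    Integrable (arcMajorant d κ L R) := by
  refine Integrable.add (integrable_finsetSum _ fun q _ => integrable_finsetSum _ fun a _ => ?_) ?_
  · exact ((integrable_inv_one_add_sq_comp _ 1 one_pos).const_mul 2).const_mul _
  · exact ((integrable_inv_one_add_sq_comp 0 L hL).const_mul 2).const_mul _

lemma arcMajorant_nonneg {d : ℕ} {κ L R : ℝ} (hκ : 0 ≤ κ) (hL : 0 ≤ L) (hR : 0 ≤ R) (s : ℝ) :
    0 ≤ arcMajorant d κ L R s := by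
  unfold arcMajorant
  positivity

lemma integral_arcMajorant_le {d : ℕ} (hd : 2 ≤ d) {κ L R : ℝ} (hκ : 0 < κ) (hL : 1 ≤ L)
    (hR : 0 ≤ R) :
    ∫ s, arcMajorant d κ L R s ≤ 2 * Real.pi * (3 * 2 ^ (d - 1) + κ⁻¹ ^ d * κ⁻¹ ^ (d - 1)) *
      (R ^ (d - 1) * L ^ 2 / L ^ d) * (1 + Real.log L) := by
  have hL0 : 0 < L := by linarith
  have hlog : 0 ≤ Real.log L := Real.log_nonneg hL
  have hpi := Real.pi_pos
  set Q := R ^ (d - 1) * L ^ 2 / L ^ d with hQ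
  have hQ0 : 0 ≤ Q := by positivity
  unfold arcMajorant
  rw [integral_add, integral_finsetSum]
  rotate_left
  · exact fun q _ => integrable_finsetSum _ fun a _ =>
      ((integrable_inv_one_add_sq_comp _ 1 one_pos).const_mul 2).const_mul _
  · exact integrable_finsetSum _ fun q _ => integrable_finsetSum _ fun a _ =>
      ((integrable_inv_one_add_sq_comp _ 1 one_pos).const_mul 2).const_mul _
  · exact ((integrable_inv_one_add_sq_comp 0 L hL0).const_mul 2).const_mul _
  have h1 : ∀ q ∈ Finset.Icc 1 ⌊L⌋₊, ∫ s : ℝ, ∑ a ∈ arcNumerators L R q,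
      (L / q) ^ d * (2 * (1 + ((s - L ^ 2 * (a / q)) / 1) ^ 2)⁻¹)
        ≤ 2 * Real.pi * (3 * 2 ^ (d - 1)) * Q * (q : ℝ)⁻¹ := by
    intro q hq
    rw [integral_finsetSum _ fun a _ =>
      ((integrable_inv_one_add_sq_comp _ 1 one_pos).const_mul 2).const_mul _]
    simp only [integral_const_mul, integral_inv_one_add_sq_comp _ 1 one_pos]
    rw [Finset.sum_const, nsmul_eq_mul]
    have := card_arcNumerators_mul_le hL hR (Finset.mem_Icc.1 hq).1 hd
    calc ((arcNumerators L R q).card : ℝ) * ((L / q) ^ d * (2 * (Real.pi * 1)))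
        = (2 * Real.pi) * (((arcNumerators L R q).card : ℝ) * (L / q) ^ d) := by ring
      _ ≤ (2 * Real.pi) * (3 * 2 ^ (d - 1) * Q * (q : ℝ)⁻¹) := by gcongr
      _ = _ := by ring
  have h2 : ∑ q ∈ Finset.Icc 1 ⌊L⌋₊, (q : ℝ)⁻¹ ≤ 1 + Real.log L := by
    have := harmonic_floor_le_one_add_log L hL
    rw [harmonic_eq_sum_Icc] at this
    push_cast at this
    exact this
  have h3 : ∫ s : ℝ, κ⁻¹ ^ d * (R / (κ * L)) ^ (d - 1) * (2 * (1 + ((s - 0) / L) ^ 2)⁻¹)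
      = 2 * Real.pi * (κ⁻¹ ^ d * κ⁻¹ ^ (d - 1)) * Q := by
    simp only [integral_const_mul, integral_inv_one_add_sq_comp 0 L hL0]
    obtain ⟨e, rfl⟩ : ∃ e, d = e + 1 := ⟨d - 1, by omega⟩
    rw [hQ, Nat.add_sub_cancel, div_pow, mul_pow, inv_pow, inv_pow]
    field_simp
    ring
  rw [h3]
  have h4 := (Finset.sum_le_sum h1)
  rw [← Finset.mul_sum] at h4
  calc _ ≤ 2 * Real.pi * (3 * 2 ^ (d - 1)) * Q * (1 + Real.log L)
        + 2 * Real.pi * (κ⁻¹ ^ d * κ⁻¹ ^ (d - 1)) * Q * (1 + Real.log L) := by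
        refine add_le_add (h4.trans (by gcongr)) (le_mul_of_one_le_right (by positivity) ?_)
        linarith
    _ = _ := by ring

lemma arcSize_pow_le_arcMajorant {d : ℕ} (hd : 2 ≤ d) {κ L R s : ℝ} (hκ : 0 < κ) (hL : 2 ≤ L)
    (hs : κ * L ≤ |s|) (hsR : |s| ≤ R) {r : ℚ} (hq : (r.den : ℝ) ≤ L)
    (hr : |s / L ^ 2 - r| * (L * r.den) ≤ 1) :
    arcSize L (s / L ^ 2) r ^ d ≤ arcMajorant d κ L R s := by
  have hL0 : 0 < L := by linarith
  have hR : 0 ≤ R := (abs_nonneg s).trans hsR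
  have hq0 : (0 : ℝ) < r.den := by exact_mod_cast r.den_pos
  have hκL : 0 < κ * L := by positivity
  have hs0 : 0 < |s| := hκL.trans_le hs
  rcases eq_or_ne r 0 with rfl | hr0
  · have h1 : arcSize L (s / L ^ 2) 0 ≤ κ⁻¹ := by
      rw [arcSize]
      simp only [Rat.den_zero, Nat.cast_one, div_one, Rat.cast_zero, sub_zero]
      have e : L ^ 2 * |s / L ^ 2| = |s| := by
        rw [abs_div, abs_of_pos (by positivity : 0 < L ^ 2)]
        field_simp
      rw [e, inv_eq_one_div, div_le_div_iff₀ (by positivity) hκ]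
      calc L * κ = κ * L := mul_comm _ _
        _ ≤ |s| := hs
        _ ≤ 1 * max 1 |s| := by rw [one_mul]; exact le_max_right _ _
    have h2 : |s| ≤ L := by
      simp only [Rat.den_zero, Nat.cast_one, mul_one, Rat.cast_zero, sub_zero] at hr
      rw [abs_div, abs_of_pos (by positivity : 0 < L ^ 2), div_mul_eq_mul_div,
        div_le_one (by positivity)] at hr
      nlinarith
    have h3 : 1 ≤ R / (κ * L) := (one_le_div hκL).2 (hs.trans hsR)
    have h4 : 1 ≤ 2 * (1 + ((s - 0) / L) ^ 2)⁻¹ := by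
      rw [← div_eq_mul_inv, one_le_div (by positivity), sub_zero, div_pow, ← sq_abs s]
      have : |s| ^ 2 / L ^ 2 ≤ 1 := (div_le_one (by positivity)).2 (by gcongr)
      linarith
    have h0 : 0 ≤ arcSize L (s / L ^ 2) 0 := by
      rw [arcSize]
      positivity
    unfold arcMajorant
    refine le_add_of_nonneg_of_le (by positivity) ?_
    calc arcSize L (s / L ^ 2) 0 ^ d ≤ κ⁻¹ ^ d * 1 * 1 := by
          rw [mul_one, mul_one]
          gcongr
      _ ≤ κ⁻¹ ^ d * (R / (κ * L)) ^ (d - 1) * (2 * (1 + ((s - 0) / L) ^ 2)⁻¹) := by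
          gcongr
          exact one_le_pow₀ h3
  · have hrq : (r : ℝ) = r.num / r.den := by exact_mod_cast (Rat.num_div_den r).symm
    have hnum : r.num ≠ 0 := Rat.num_ne_zero.2 hr0
    have hnum1 : (1 : ℝ) ≤ |(r.num : ℝ)| := by exact_mod_cast Int.one_le_abs hnum
    have hmem : r.num ∈ arcNumerators L R r.den := by
      rw [mem_arcNumerators]
      refine ⟨?_, hnum⟩
      have h1 : |(r.num : ℝ)| ≤ r.den * |s / L ^ 2| + r.den * |s / L ^ 2 - r| := by
        have e : (r.num : ℝ) = r.den * (s / L ^ 2) - r.den * (s / L ^ 2 - r) := by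
          rw [hrq]
          field_simp
          ring
        calc |(r.num : ℝ)| = |r.den * (s / L ^ 2) - r.den * (s / L ^ 2 - r)| := by rw [← e]
          _ ≤ _ := by
            refine (abs_sub _ _).trans_eq ?_
            rw [abs_mul, abs_mul, abs_of_pos hq0]
      have h2 : r.den * |s / L ^ 2 - r| ≤ 1 / 2 := by
        have : 0 ≤ |s / L ^ 2 - r| * r.den := by positivity
        nlinarith
      have h3 : |s / L ^ 2| ≤ R / L ^ 2 := by
        rw [abs_div, abs_of_pos (by positivity : 0 < L ^ 2)]
        gcongr
      have h4 : r.den * |s / L ^ 2| ≤ r.den * (R / L ^ 2) := by gcongr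
      have e : 2 * R * r.den / L ^ 2 = 2 * (r.den * (R / L ^ 2)) := by ring
      rw [e]
      linarith
    have hden : r.den ∈ Finset.Icc 1 ⌊L⌋₊ :=
      Finset.mem_Icc.2 ⟨r.den_pos, Nat.le_floor hq⟩
    unfold arcMajorant
    refine le_add_of_le_of_nonneg ?_ (by positivity)
    refine le_trans ?_ (Finset.single_le_sum (f := fun q : ℕ => ∑ a ∈ arcNumerators L R q,
      (L / q) ^ d * (2 * (1 + ((s - L ^ 2 * (a / q)) / 1) ^ 2)⁻¹))
      (fun q _ => Finset.sum_nonneg fun a _ => by positivity) hden)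
    refine le_trans ?_ (Finset.single_le_sum (f := fun a : ℤ =>
      (L / (r.den : ℕ)) ^ d * (2 * (1 + ((s - L ^ 2 * (a / (r.den : ℕ))) / 1) ^ 2)⁻¹))
      (fun a _ => by positivity) hmem)
    refine (arcSize_pow_le (by linarith) hd).trans_eq ?_
    have e : L ^ 2 * (s / L ^ 2 - r) = (s - L ^ 2 * (r.num / r.den)) / 1 := by
      rw [hrq]
      field_simp
    rw [e]

lemma weight_le_one {P : ℝ} (hP : 0 ≤ P) (u : ℝ) : Real.sqrt (1 + u ^ 2) ^ (-P) ≤ 1 :=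
  Real.rpow_le_one_of_one_le_of_nonpos
    (Real.one_le_sqrt.2 (by nlinarith [sq_nonneg u])) (by linarith)

lemma weight_le_of_large {P δ ℓ L ε s : ℝ} {k : ℕ} (hδ : 0 < δ) (hδ1 : δ < 1) (hℓ : 0 < ℓ)
    (hL : 1 ≤ L) (hP : 2 ≤ P) (hεP : k ≤ ε * (P - 2)) (hs : ℓ * L ^ ε ≤ |s|) :
    Real.sqrt (1 + (s / (δ * ℓ)) ^ 2) ^ (-P) ≤ (1 + ((s - 0) / ℓ) ^ 2)⁻¹ * (L ^ k)⁻¹ := by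
  have hL0 : 0 < L := by linarith
  rw [sub_zero]
  set y := Real.sqrt (1 + (s / ℓ) ^ 2) with hy
  have hy0 : 0 < y := Real.sqrt_pos.2 (by positivity)
  have hxy : y ≤ Real.sqrt (1 + (s / (δ * ℓ)) ^ 2) := by
    apply Real.sqrt_le_sqrt
    rw [div_pow, div_pow]
    gcongr
    nlinarith
  have hy2 : y ^ 2 = 1 + (s / ℓ) ^ 2 := Real.sq_sqrt (by positivity)
  have hyL : L ^ ε ≤ y := by
    apply Real.le_sqrt_of_sq_le
    have : L ^ ε ≤ |s / ℓ| := by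
      rw [abs_div, abs_of_pos hℓ, le_div_iff₀ hℓ]
      linarith
    have h0 : 0 ≤ L ^ ε := by positivity
    rw [← sq_abs (s / ℓ)]
    nlinarith
  calc Real.sqrt (1 + (s / (δ * ℓ)) ^ 2) ^ (-P) ≤ y ^ (-P) :=
        Real.rpow_le_rpow_of_nonpos hy0 hxy (by linarith)
    _ = (y ^ 2)⁻¹ * y ^ (-(P - 2)) := by
        rw [← Real.rpow_natCast, ← Real.rpow_neg hy0.le, ← Real.rpow_add hy0]
        congr 1
        push_cast
        ring
    _ ≤ (y ^ 2)⁻¹ * (L ^ k)⁻¹ := by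
        gcongr
        calc y ^ (-(P - 2)) ≤ (L ^ ε) ^ (-(P - 2)) :=
              Real.rpow_le_rpow_of_nonpos (by positivity) hyL (by linarith)
          _ = L ^ (-(ε * (P - 2))) := by
              rw [← Real.rpow_mul hL0.le]
              congr 1
              ring
          _ ≤ L ^ (-(k : ℝ)) := Real.rpow_le_rpow_of_exponent_le hL (by linarith)
          _ = (L ^ k)⁻¹ := by rw [Real.rpow_neg hL0.le, Real.rpow_natCast]
    _ = _ := by rw [hy2]

lemma latSum_eq_zero {d : ℕ} {χ : ℝ → ℝ}
    {Φ : ℝ → EuclideanSpace ℝ (Fin d) → EuclideanSpace ℝ (Fin d) → ℂ} {s : ℝ}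
    (h : ∀ x y, Φ s x y = 0) (lam L : ℝ) (a b ξ ζ : EuclideanSpace ℝ (Fin d)) :
    latSum d χ Φ lam L s a b ξ ζ = 0 := by
  simp [latSum, h]

lemma prod_sum_freqWeight_le_arc {d : ℕ} (hd : 2 ≤ d) {κ L R lam s : ℝ} (hκ : 0 < κ) (hL : 2 ≤ L)
    (hlam : 1 ≤ lam) (hs : κ * L ≤ |s|) (hsR : |s| ≤ R) (a ζ : EuclideanSpace ℝ (Fin d)) :
    ∏ j, ∑ n ∈ latBox L lam (a j), freqWeight L (ζ j / L + s * n / L ^ 2)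
      ≤ (35 * cellMass * lam ^ 2) ^ d * arcMajorant d κ L R s := by
  have hL1 : 1 ≤ L := by linarith
  obtain ⟨r, hq, hr⟩ := exists_rat_arc hL1 (s / L ^ 2)
  have hc := cellMass_nonneg
  calc ∏ j, ∑ n ∈ latBox L lam (a j), freqWeight L (ζ j / L + s * n / L ^ 2)
      ≤ ∏ j : Fin d, (35 * cellMass * lam ^ 2 * arcSize L (s / L ^ 2) r) := by
        refine Finset.prod_le_prod
          (fun j _ => Finset.sum_nonneg fun n _ => freqWeight_nonneg _ _) fun j _ => ?_
        simp only [mul_div_right_comm s]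
        exact sum_latBox_freqWeight_le hL1 hlam hq hr _ _
    _ = (35 * cellMass * lam ^ 2) ^ d * arcSize L (s / L ^ 2) r ^ d := by
        simp [mul_pow]
    _ ≤ _ := by
        gcongr
        exact arcSize_pow_le_arcMajorant hd hκ hL hs hsR hq hr

lemma prod_sum_freqWeight_le_card {d : ℕ} {L lam s : ℝ} (hL : 1 ≤ L) (hlam : 1 ≤ lam)
    (a ζ : EuclideanSpace ℝ (Fin d)) :
    ∏ j, ∑ n ∈ latBox L lam (a j), freqWeight L (ζ j / L + s * n / L ^ 2)
      ≤ (3 * (lam * L)) ^ d := by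
  calc ∏ j, ∑ n ∈ latBox L lam (a j), freqWeight L (ζ j / L + s * n / L ^ 2)
      ≤ ∏ j : Fin d, (3 * (lam * L)) := by
        refine Finset.prod_le_prod
          (fun j _ => Finset.sum_nonneg fun n _ => freqWeight_nonneg _ _) fun j _ => ?_
        refine (Finset.sum_le_sum fun n _ => freqWeight_le_one _ _).trans ?_
        simpa using card_latBox_le (b := a j) hL hlam
    _ = _ := by simp

lemma rpow_pow_mul_log_le {d : ℕ} (hd : 1 ≤ d) {γ ε L : ℝ} (hε : 0 < ε) (hL : 1 ≤ L) :
    (L ^ (2 * γ) * L ^ ε) ^ (d - 1) * L ^ 2 * (1 + Real.log L)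
      ≤ (1 + ε⁻¹) * L ^ (2 * (d : ℝ) - 2 * ((d : ℝ) - 1) * (1 - γ) + d * ε) := by
  have hL0 : 0 < L := by linarith
  have h1 : 1 + Real.log L ≤ (1 + ε⁻¹) * L ^ ε := by
    have h2 := Real.log_le_rpow_div hL0.le hε
    have h3 : 1 ≤ L ^ ε := Real.one_le_rpow hL hε.le
    calc 1 + Real.log L ≤ L ^ ε + L ^ ε / ε := add_le_add h3 h2
      _ = _ := by ring
  obtain ⟨e, rfl⟩ : ∃ e, d = e + 1 := ⟨d - 1, by omega⟩
  calc (L ^ (2 * γ) * L ^ ε) ^ (e + 1 - 1) * L ^ 2 * (1 + Real.log L)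
      ≤ (L ^ (2 * γ) * L ^ ε) ^ (e + 1 - 1) * L ^ 2 * ((1 + ε⁻¹) * L ^ ε) := by gcongr
    _ = (1 + ε⁻¹) * (L ^ ((2 * γ + ε) * e) * L ^ (2 : ℝ) * L ^ ε) := by
        rw [Nat.add_sub_cancel, ← Real.rpow_add hL0, Real.rpow_mul hL0.le, Real.rpow_natCast,
          Real.rpow_two]
        ring
    _ = _ := by
        rw [← Real.rpow_add hL0, ← Real.rpow_add hL0]
        congr 2
        push_cast
        ring

/-- The pointwise majorant of the weighted lattice sum. -/
lemma weight_mul_norm_latSum_le {d : ℕ} (hd : 2 ≤ d) {χ : ℝ → ℝ} {K : ℝ} (hK : CutoffBound χ K)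
    (hχ0 : ∀ z : ℝ, 1 ≤ |z| → χ z = 0)
    {Φ : ℝ → EuclideanSpace ℝ (Fin d) → EuclideanSpace ℝ (Fin d) → ℂ}
    {κ L lam D δ ℓ ε P : ℝ} (hκ : 0 < κ) (hL : 2 ≤ L) (hlam : 1 ≤ lam) (hD0 : 0 ≤ D) (hδ : 0 < δ)
    (hδ1 : δ < 1) (hℓ : 0 < ℓ) (hP : 2 ≤ P) (hεP : ((2 * d : ℕ) : ℝ) ≤ ε * (P - 2))
    (hΦ : ∀ s, ContDiff ℝ (20 * d : ℕ)
        (fun p : EuclideanSpace ℝ (Fin d) × EuclideanSpace ℝ (Fin d) => Φ s p.1 p.2))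
    (hD : PhiDerivBound d D Φ) (hsupp : ∀ s x y, |s| < κ * L → Φ s x y = 0)
    (a b ξ ζ : EuclideanSpace ℝ (Fin d)) (s : ℝ) :
    Real.sqrt (1 + (s / (δ * ℓ)) ^ 2) ^ (-P) * ‖latSum d χ Φ lam L s a b ξ ζ‖ ≤
      K ^ d * (6 * K * lam * L) ^ d * D * ((35 * cellMass * lam ^ 2) ^ d *
        arcMajorant d κ L (ℓ * L ^ ε) s +
          (3 * (lam * L)) ^ d * (L ^ (2 * d))⁻¹ * (1 + ((s - 0) / ℓ) ^ 2)⁻¹) := by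
  have hL1 : 1 ≤ L := by linarith
  have hK0 : 0 ≤ K := (norm_nonneg _).trans (hK.norm_le 0)
  have hc := cellMass_nonneg
  have hG := arcMajorant_nonneg (d := d) hκ.le (by linarith : 0 ≤ L)
    (by positivity : 0 ≤ ℓ * L ^ ε) s
  have hA : 0 ≤ K ^ d * (6 * K * lam * L) ^ d * D := by positivity
  rcases lt_or_ge |s| (κ * L) with hs | hs
  · rw [latSum_eq_zero fun x y => hsupp s x y hs, norm_zero, mul_zero]
    positivity
  · have hmain := norm_latSum_le hK hχ0 hL1 hlam (hΦ s) hD a b ξ ζ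
    rcases le_or_gt |s| (ℓ * L ^ ε) with hsR | hsR
    · calc _ ≤ 1 * ‖latSum d χ Φ lam L s a b ξ ζ‖ := by
            gcongr
            exact weight_le_one (by linarith) _
        _ ≤ K ^ d * (6 * K * lam * L) ^ d * D * ((35 * cellMass * lam ^ 2) ^ d *
              arcMajorant d κ L (ℓ * L ^ ε) s) := by
            rw [one_mul]
            exact hmain.trans (mul_le_mul_of_nonneg_left
              (prod_sum_freqWeight_le_arc hd hκ hL hlam hs hsR a ζ) hA)
        _ ≤ _ := mul_le_mul_of_nonneg_left (le_add_of_nonneg_right (by positivity)) hA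
    · calc _ ≤ ((1 + ((s - 0) / ℓ) ^ 2)⁻¹ * (L ^ (2 * d))⁻¹) *
              (K ^ d * (6 * K * lam * L) ^ d * D * (3 * (lam * L)) ^ d) := by
            refine mul_le_mul (weight_le_of_large hδ hδ1 hℓ hL1 hP hεP hsR.le) ?_
              (norm_nonneg _) (by positivity)
            exact hmain.trans (mul_le_mul_of_nonneg_left
              (prod_sum_freqWeight_le_card hL1 hlam a ζ) hA)
        _ = K ^ d * (6 * K * lam * L) ^ d * D * ((3 * (lam * L)) ^ d * (L ^ (2 * d))⁻¹ *
              (1 + ((s - 0) / ℓ) ^ 2)⁻¹) := by ring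
        _ ≤ _ := mul_le_mul_of_nonneg_left (le_add_of_nonneg_left (by positivity)) hA

lemma lintegral_ofReal_mul_nnnorm_le {w G : ℝ → ℝ} {f : ℝ → ℂ} (hw : ∀ s, 0 ≤ w s)
    (h : ∀ s, w s * ‖f s‖ ≤ G s) (hG : Integrable G) {I : ℝ} (hI : ∫ s, G s ≤ I) :
    ∫⁻ s, ENNReal.ofReal (w s) * (‖f s‖₊ : ℝ≥0∞) ≤ ENNReal.ofReal I := by
  have hG0 : ∀ s, 0 ≤ G s := fun s => (mul_nonneg (hw s) (norm_nonneg _)).trans (h s)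
  calc ∫⁻ s, ENNReal.ofReal (w s) * (‖f s‖₊ : ℝ≥0∞) ≤ ∫⁻ s, ENNReal.ofReal (G s) := by
        refine lintegral_mono fun s => ?_
        rw [← ENNReal.ofReal_coe_nnreal, coe_nnnorm, ← ENNReal.ofReal_mul (hw s)]
        exact ENNReal.ofReal_le_ofReal (h s)
    _ = ENNReal.ofReal (∫ s, G s) :=
        (ofReal_integral_eq_lintegral_ofReal hG (Filter.Eventually.of_forall hG0)).symm
    _ ≤ _ := ENNReal.ofReal_le_ofReal hI

lemma majorant_bound_le (d : ℕ) {K c M D lam L ℓ I Q E T : ℝ} (hK : 0 ≤ K) (hc : 0 ≤ c)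
    (hM : 0 ≤ M) (hD : 0 ≤ D) (hlam : 1 ≤ lam) (hL : 0 < L) (hT : 0 ≤ T) (hE : 0 ≤ E)
    (hI : I ≤ M * (Q / L ^ d)) (hQ : Q ≤ E * T) (hℓ : ℓ ≤ T) :
    K ^ d * (6 * K * lam * L) ^ d * D * ((35 * c * lam ^ 2) ^ d * I +
        (3 * (lam * L)) ^ d * (L ^ (2 * d))⁻¹ * (Real.pi * ℓ)) ≤
      K ^ d * (6 * K) ^ d * ((35 * c) ^ d * M * E + 3 ^ d * Real.pi) * D * lam ^ (4 * d) * T := by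
  have hlam3 : lam ^ (3 * d) ≤ lam ^ (4 * d) := pow_le_pow_right₀ hlam (by omega)
  have hlam2 : lam ^ (2 * d) ≤ lam ^ (4 * d) := pow_le_pow_right₀ hlam (by omega)
  have hA : 0 ≤ K ^ d * (6 * K) ^ d * D := by positivity
  have h₁ : (6 * K * lam * L) ^ d * ((35 * c * lam ^ 2) ^ d * (M * (Q / L ^ d))) =
      (6 * K) ^ d * ((35 * c) ^ d * M * (lam ^ (3 * d) * Q)) := by
    rw [mul_pow _ L, mul_pow (6 * K), mul_pow (35 * c), show 3 * d = d + 2 * d by omega, pow_add,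
      pow_mul]
    field_simp
  have h₂ : (6 * K * lam * L) ^ d * ((3 * (lam * L)) ^ d * (L ^ (2 * d))⁻¹ * (Real.pi * ℓ)) =
      (6 * K) ^ d * (3 ^ d * Real.pi * (lam ^ (2 * d) * ℓ)) := by
    rw [mul_pow _ L, mul_pow (6 * K), mul_pow 3, mul_pow lam L, two_mul, pow_add, pow_add]
    field_simp
  have h₃ : lam ^ (3 * d) * Q ≤ lam ^ (4 * d) * (E * T) :=
    (mul_le_mul_of_nonneg_left hQ (by positivity)).trans
      (mul_le_mul_of_nonneg_right hlam3 (by positivity))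
  have h₄ : lam ^ (2 * d) * ℓ ≤ lam ^ (4 * d) * T :=
    (mul_le_mul_of_nonneg_left hℓ (by positivity)).trans
      (mul_le_mul_of_nonneg_right hlam2 hT)
  calc _ ≤ K ^ d * (6 * K * lam * L) ^ d * D * ((35 * c * lam ^ 2) ^ d * (M * (Q / L ^ d)) +
        (3 * (lam * L)) ^ d * (L ^ (2 * d))⁻¹ * (Real.pi * ℓ)) := by gcongr
    _ = K ^ d * (6 * K) ^ d * D * ((35 * c) ^ d * M * (lam ^ (3 * d) * Q) +
        3 ^ d * Real.pi * (lam ^ (2 * d) * ℓ)) := by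
      linear_combination K ^ d * D * (h₁ + h₂)
    _ ≤ K ^ d * (6 * K) ^ d * D * ((35 * c) ^ d * M * (lam ^ (4 * d) * (E * T)) +
        3 ^ d * Real.pi * (lam ^ (4 * d) * T)) := by
      refine mul_le_mul_of_nonneg_left (add_le_add ?_ ?_) hA
      · exact mul_le_mul_of_nonneg_left h₃ (by positivity)
      · exact mul_le_mul_of_nonneg_left h₄ (by positivity)
    _ = _ := by ring

theorem statement15 (d : ℕ) (hd : 3 ≤ d) (γ : ℝ) (hγ : 0 < γ) (hγ' : γ < 1) (χ₀ : ℝ → ℝ)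
    (hχs : ContDiff ℝ (⊤ : ℕ∞) χ₀)
    (hχ1 : ∀ z : ℝ, |z| ≤ 1 / 2 → χ₀ z = 1)
    (hχ0 : ∀ z : ℝ, 1 ≤ |z| → χ₀ z = 0) :
    ∃ η₀ : ℝ, 0 < η₀ ∧ ∀ η : ℝ, 0 < η → η ≤ η₀ →
    ∀ κ : ℝ, 0 < κ →
    ∃ C : ℝ, 2 ≤ C ∧
    ∀ P : ℝ, η⁻¹ ^ 2 ≤ P →
    ∀ L : ℝ, C ≤ L →
    ∀ δ : ℝ, 0 < δ → δ < 1 → δ⁻¹ ≤ L ^ (η ^ 2) →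
    ∀ lam : ℝ, 1 ≤ lam → lam ≤ Real.log L ^ 4 →
    ∀ D : ℝ, 0 < D →
    ∀ Φ : ℝ → EuclideanSpace ℝ (Fin d) → EuclideanSpace ℝ (Fin d) → ℂ,
      (∀ s : ℝ, ContDiff ℝ (20 * d : ℕ)
        (fun p : EuclideanSpace ℝ (Fin d) × EuclideanSpace ℝ (Fin d) => Φ s p.1 p.2)) →
      PhiDerivBound d D Φ →
      (∀ (s : ℝ) (x y : EuclideanSpace ℝ (Fin d)), |s| < κ * L → Φ s x y = 0) →
    ∀ a b ξ ζ : EuclideanSpace ℝ (Fin d),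
      (∫⁻ s : ℝ,
          ENNReal.ofReal (Real.sqrt (1 + (s / (δ * L ^ (2 * γ))) ^ 2) ^ (-P)) *
            (‖latSum d χ₀ Φ lam L s a b ξ ζ‖₊ : ℝ≥0∞))
        ≤ ENNReal.ofReal (C * D * lam ^ (4 * (d : ℝ)) *
            L ^ (2 * (d : ℝ) - 2 * ((d : ℝ) - 1) * (1 - γ) + η)) := by
  obtain ⟨K, hK1, hK⟩ := exists_cutoffBound hχs hχ0
  have hd0 : (3 : ℝ) ≤ d := by exact_mod_cast hd
  have hdpos : (0 : ℝ) < d := by linarith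
  refine ⟨1 / (4 * d ^ 2), by positivity, fun η hη hη0 κ hκ => ?_⟩
  set M := 2 * Real.pi * (3 * 2 ^ (d - 1) + κ⁻¹ ^ d * κ⁻¹ ^ (d - 1)) with hM
  set ε := η / d with hε
  have hε0 : 0 < ε := by positivity
  have hc := cellMass_nonneg
  set C₁ := K ^ d * (6 * K) ^ d *
    ((35 * cellMass) ^ d * M * (1 + ε⁻¹) + 3 ^ d * Real.pi) with hC₁
  refine ⟨max 2 C₁, le_max_left _ _, ?_⟩
  intro P hP L hCL δ hδ hδ1 _ lam hlam _ D hD Φ hΦ hΦD hsupp a b ξ ζ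
  have hL : 2 ≤ L := (le_max_left _ _).trans hCL
  have hL1 : 1 ≤ L := by linarith
  have hL0 : 0 < L := by linarith
  have hηd : η * (4 * d ^ 2) ≤ 1 := by
    rwa [le_div_iff₀ (by positivity)] at hη0
  have hηinv : 4 * d ^ 2 ≤ η⁻¹ := by
    rw [← one_div, le_div_iff₀ hη]
    linarith
  have hηinv2 : 2 ≤ η⁻¹ := by nlinarith
  have hP2 : 2 ≤ P := by nlinarith
  have hεP : ((2 * d : ℕ) : ℝ) ≤ ε * (P - 2) := by
    have h1 : η * η⁻¹ = 1 := mul_inv_cancel₀ hη.ne'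
    have h2 : η * (η⁻¹ ^ 2 - 2) ≤ η * (P - 2) := by gcongr
    have h3 : η * (η⁻¹ ^ 2 - 2) = η⁻¹ - 2 * η := by
      rw [mul_sub, sq, ← mul_assoc, h1]
      ring
    have h4 : (2 * d : ℝ) * d ≤ η * (P - 2) := by nlinarith
    rw [hε, div_mul_eq_mul_div, le_div_iff₀ hdpos]
    push_cast
    exact h4
  set ℓ := L ^ (2 * γ) with hℓ
  have hℓ0 : 0 < ℓ := by positivity
  have hR0 : 0 ≤ ℓ * L ^ ε := by positivity
  refine lintegral_ofReal_mul_nnnorm_le (fun s => by positivity)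
    (fun s => weight_mul_norm_latSum_le (by omega) hK hχ0 hκ hL hlam hD.le hδ hδ1 hℓ0 hP2 hεP hΦ
      hΦD hsupp a b ξ ζ s) ?_ ?_
  · exact (((integrable_arcMajorant d κ _ hL0).const_mul _).add
      ((integrable_inv_one_add_sq_comp 0 ℓ hℓ0).const_mul _)).const_mul _
  · rw [integral_const_mul, integral_add ((integrable_arcMajorant d κ _ hL0).const_mul _)
      ((integrable_inv_one_add_sq_comp 0 ℓ hℓ0).const_mul _), integral_const_mul,
      integral_const_mul, integral_inv_one_add_sq_comp 0 ℓ hℓ0]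
    have hG := integral_arcMajorant_le (d := d) (by omega) hκ hL1 hR0
    have hrp := rpow_pow_mul_log_le (d := d) (γ := γ) (by omega) hε0 hL1
    have hdε : (d : ℝ) * ε = η := by
      rw [hε]
      field_simp
    rw [hdε, ← hℓ] at hrp
    rw [← hM] at hG
    have hM0 : 0 ≤ M := by positivity
    have hlamd : lam ^ (4 * (d : ℝ)) = lam ^ (4 * d) := by
      rw [← Real.rpow_natCast]
      push_cast
      rfl
    have hLE : ℓ ≤ L ^ (2 * (d : ℝ) - 2 * ((d : ℝ) - 1) * (1 - γ) + η) := by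
      apply Real.rpow_le_rpow_of_exponent_le hL1
      nlinarith
    set T := L ^ (2 * (d : ℝ) - 2 * ((d : ℝ) - 1) * (1 - γ) + η) with hT
    have hT0 : 0 < T := by positivity
    rw [hlamd]
    refine (majorant_bound_le (I := ∫ s, arcMajorant d κ L (ℓ * L ^ ε) s)
      (Q := (ℓ * L ^ ε) ^ (d - 1) * L ^ 2 * (1 + Real.log L)) (E := 1 + ε⁻¹) d
      (by linarith) hc hM0 hD.le hlam hL0 hT0.le (by positivity) (hG.trans_eq (by ring)) hrp
      hLE).trans ?_
    gcongr
    exact le_max_right _ _
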